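/- arXiv:2110.07753 — 4 statements merged into one kernel-verified Lean document; each statement's English description precedes it below -/
import Mathlib

section
/- Let n ≥ 1 and Δ = 2^n. For any integers 0 ≤ l < u ≤ Δ, the vector H·𝟙_{[l,u)} (the Haar wavelet transform of the indicator vector of the range [l,u)) has at most 2n + 2 nonzero entries. -/
open Matrix

/-- The scale of the Haar row index `i`: row `0` is the special row of scale `-1`;
row `i ≥ 1` corresponds to the pair `(m, j)` with `m = ⌊log₂ i⌋` and `j = i - 2^m`. -/
def haarScale (i : ℕ) : ℤ := if i = 0 then -1 else (Nat.log 2 i : ℤ)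

/-- Entry of the `2^n × 2^n` Haar matrix, with rows indexed by `i ∈ [0, 2^n)` via the
standard bijection `i = 0 ↔ (m, j) = (-1, 0)` and `i = 2^m + j ↔ (m, j)` for `m ≥ 0`,
`0 ≤ j < 2^m`.  The row `(-1, 0)` is constant `Δ^{-1/2}`; the row `(m, j)` with `m ≥ 0`
takes the value `√(2^m/Δ)` on `[jΔ/2^m, jΔ/2^m + Δ/2^(m+1))`, the value `-√(2^m/Δ)` on
`[jΔ/2^m + Δ/2^(m+1), (j+1)Δ/2^m)`, and `0` elsewhere, where `Δ = 2^n`. -/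
noncomputable def haarEntry (n : ℕ) (i c : ℕ) : ℝ :=
  if i = 0 then (Real.sqrt (2 ^ n))⁻¹
  else
    let m := Nat.log 2 i
    let j := i - 2 ^ m
    if j * (2 ^ n / 2 ^ m) ≤ c ∧ c < j * (2 ^ n / 2 ^ m) + 2 ^ n / 2 ^ (m + 1) then
      Real.sqrt ((2 ^ m : ℝ) / 2 ^ n)
    else if j * (2 ^ n / 2 ^ m) + 2 ^ n / 2 ^ (m + 1) ≤ c ∧ c < (j + 1) * (2 ^ n / 2 ^ m) then
      -Real.sqrt ((2 ^ m : ℝ) / 2 ^ n)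
    else 0

/-- The `2^n × 2^n` Haar matrix. -/
noncomputable def haarMatrix (n : ℕ) : Matrix (Fin (2 ^ n)) (Fin (2 ^ n)) ℝ :=
  Matrix.of fun i c => haarEntry n i.val c.val

/-- The indicator vector of the range `[l, u)` in the universe `[0, Δ)`. -/
def indVec (Δ l u : ℕ) : Fin Δ → ℝ := fun c => if l ≤ (c : ℕ) ∧ (c : ℕ) < u then 1 else 0

/-- The row of scale `m` and shift `j` is a multiple of the difference of the indicators of two
adjacent intervals of the same length. -/
lemma haarEntry_two_pow_add (m k j c : ℕ) (hj : j < 2 ^ m) :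
    haarEntry (m + k + 1) (2 ^ m + j) c = Real.sqrt ((2 ^ m : ℝ) / 2 ^ (m + k + 1)) *
      ((if c ∈ Finset.Ico (j * 2 ^ (k + 1)) (j * 2 ^ (k + 1) + 2 ^ k) then 1 else 0) -
        (if c ∈ Finset.Ico (j * 2 ^ (k + 1) + 2 ^ k) ((j + 1) * 2 ^ (k + 1)) then 1 else 0)) := by
  have hpos : 0 < 2 ^ m := by positivity
  have hlog : Nat.log 2 (2 ^ m + j) = m :=
    Nat.log_eq_of_pow_le_of_lt_pow (by omega) (by rw [pow_succ]; omega)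
  have hblock : 2 ^ (m + k + 1) / 2 ^ m = 2 ^ (k + 1) := by
    rw [Nat.pow_div (by omega) (by norm_num)]; congr 1; omega
  have hhalf : 2 ^ (m + k + 1) / 2 ^ (m + 1) = 2 ^ k := by
    rw [Nat.pow_div (by omega) (by norm_num)]; congr 1; omega
  unfold haarEntry
  rw [if_neg (by omega)]
  simp only [hlog, Nat.add_sub_cancel_left, hblock, hhalf, Finset.mem_Ico]
  split_ifs <;> first | omega | simp

/-- The entries of a row of nonnegative scale sum to zero. -/
lemma sum_haarEntry_two_pow_add (m k j : ℕ) (hj : j < 2 ^ m) :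
    ∑ c : Fin (2 ^ (m + k + 1)), haarEntry (m + k + 1) (2 ^ m + j) c = 0 := by
  have hend : (j + 1) * 2 ^ (k + 1) ≤ 2 ^ (m + k + 1) := by
    rw [add_assoc, pow_add 2 m]
    exact Nat.mul_le_mul_right _ hj
  have hsplit : (j + 1) * 2 ^ (k + 1) = j * 2 ^ (k + 1) + 2 ^ k + 2 ^ k := by ring
  have hmid : j * 2 ^ (k + 1) + 2 ^ k ≤ 2 ^ (m + k + 1) :=
    le_trans (hsplit ▸ Nat.le_add_right _ _) hend
  have hsum (a b : ℕ) (hb : b ≤ 2 ^ (m + k + 1)) :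
      ∑ c ∈ Finset.range (2 ^ (m + k + 1)), (if c ∈ Finset.Ico a b then (1 : ℝ) else 0) =
        ((b - a : ℕ) : ℝ) := by
    rw [Finset.sum_ite_mem, Finset.inter_eq_right.mpr]
    · simp
    · intro c hc
      simp only [Finset.mem_Ico, Finset.mem_range] at hc ⊢
      omega
  rw [Fin.sum_univ_eq_sum_range (fun c => haarEntry (m + k + 1) (2 ^ m + j) c)]
  simp_rw [haarEntry_two_pow_add m k j _ hj]
  rw [← Finset.mul_sum, Finset.sum_sub_distrib, hsum _ _ hmid, hsum _ _ hend, hsplit]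
  simp

/-- A nonzero coefficient of scale `m` and shift `j` forces an endpoint of the range to lie in
the support of the row. -/
lemma div_eq_of_sum_haarEntry_mul_indVec_ne_zero (m k j l u : ℕ) (hj : j < 2 ^ m)
    (h : ∑ c : Fin (2 ^ (m + k + 1)), haarEntry (m + k + 1) (2 ^ m + j) c *
      indVec (2 ^ (m + k + 1)) l u c ≠ 0) :
    l / 2 ^ (k + 1) = j ∨ u / 2 ^ (k + 1) = j := by
  by_contra! hne
  apply h
  have hpos : 0 < 2 ^ (k + 1) := by positivity
  have outside (x : ℕ) (hx : x / 2 ^ (k + 1) ≠ j) :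
      x < j * 2 ^ (k + 1) ∨ (j + 1) * 2 ^ (k + 1) ≤ x := by
    rcases lt_or_gt_of_ne hx with hx | hx
    · exact Or.inl ((Nat.div_lt_iff_lt_mul hpos).mp hx)
    · exact Or.inr ((Nat.le_div_iff_mul_le hpos).mp hx)
  have hl := outside l hne.1
  have hu := outside u hne.2
  have hsplit : (j + 1) * 2 ^ (k + 1) = j * 2 ^ (k + 1) + 2 ^ k + 2 ^ k := by ring
  have hconst (c : Fin (2 ^ (m + k + 1))) :
      haarEntry (m + k + 1) (2 ^ m + j) c * indVec (2 ^ (m + k + 1)) l u c =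
        haarEntry (m + k + 1) (2 ^ m + j) c *
          (if l ≤ j * 2 ^ (k + 1) ∧ j * 2 ^ (k + 1) < u then 1 else 0) := by
    by_cases hc : j * 2 ^ (k + 1) ≤ (c : ℕ) ∧ (c : ℕ) < (j + 1) * 2 ^ (k + 1)
    · congr 1
      exact if_congr (by omega) rfl rfl
    · rw [haarEntry_two_pow_add m k j _ hj]
      simp only [Finset.mem_Ico]
      rw [if_neg (by omega), if_neg (by omega)]
      simp
  rw [Finset.sum_congr rfl fun c _ => hconst c, ← Finset.sum_mul,
    sum_haarEntry_two_pow_add m k j hj, zero_mul]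

/-- For `n ≥ 1`, `Δ = 2^n` and any `0 ≤ l < u ≤ Δ`, the Haar wavelet transform
`H · 𝟙_{[l,u)}` has at most `2n + 2` nonzero entries. -/
theorem haar_indicator_nonzero_card_le (n : ℕ) (hn : 1 ≤ n) (l u : ℕ)
    (hlu : l < u) (hu : u ≤ 2 ^ n) :
    (Finset.univ.filter fun i : Fin (2 ^ n) =>
      (haarMatrix n).mulVec (indVec (2 ^ n) l u) i ≠ 0).card ≤ 2 * n + 2 := by
  let row (x m : ℕ) : ℕ := 2 ^ m + x / 2 ^ (n - m)
  let cover : Finset ℕ :=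
    {0} ∪ ((Finset.range n).image (row l) ∪ (Finset.range n).image (row u))
  have hcover : cover.card ≤ 2 * n + 2 := by
    have h₁ := Finset.card_union_le {0}
      ((Finset.range n).image (row l) ∪ (Finset.range n).image (row u))
    have h₂ := Finset.card_union_le ((Finset.range n).image (row l))
      ((Finset.range n).image (row u))
    have h₃ := Finset.card_image_le (s := Finset.range n) (f := row l)
    have h₄ := Finset.card_image_le (s := Finset.range n) (f := row u)
    simp only [Finset.card_range, Finset.card_singleton] at h₁ h₂ h₃ h₄
    simp only [cover]
    omega
  refine le_trans (Finset.card_le_card_of_injOn Fin.val ?_ Fin.val_injective.injOn) hcover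
  intro i hi
  replace hi := (Finset.mem_filter.mp hi).2
  rw [Finset.mem_coe]
  obtain ⟨i, hin⟩ := i
  rcases Nat.eq_zero_or_pos i with rfl | hipos
  · simp [cover]
  obtain ⟨j, hj⟩ := Nat.exists_eq_add_of_le (Nat.pow_log_le_self 2 hipos.ne')
  have hlt := Nat.lt_pow_succ_log_self Nat.one_lt_two i
  have hm : Nat.log 2 i < n := Nat.log_lt_of_lt_pow hipos.ne' hin
  generalize Nat.log 2 i = m at hj hlt hm
  subst hj
  obtain ⟨k, rfl⟩ := Nat.exists_eq_add_of_lt hm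
  have hjm : j < 2 ^ m := by rw [pow_succ] at hlt; omega
  have hk : m + k + 1 - m = k + 1 := by omega
  simp only [cover, Finset.mem_union, Finset.mem_image, Finset.mem_range]
  rcases div_eq_of_sum_haarEntry_mul_indVec_ne_zero m k j l u hjm hi with h | h
  · exact Or.inr (Or.inl ⟨m, hm, by simp only [row, hk, h]⟩)
  · exact Or.inr (Or.inr ⟨m, hm, by simp only [row, hk, h]⟩)
end

section
/- Let n ≥ 1 and Δ = 2^n. For any integers 0 ≤ l < u ≤ Δ and any fixed scale m ∈ {−1,0,…,n−1}, the vector H·𝟙_{[l,u)} has at most 2 nonzero entries among the coordinates whose row index has scale m. -/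
open Matrix

/-- On a row of nonnegative scale `p = log₂ i`, with `n = p + 1 + k`, the Haar entry is a multiple
of the difference of the indicators of two adjacent intervals of length `2 ^ k`. -/
theorem haarEntry_eq_sub {n i k : ℕ} (hi : i ≠ 0) (hk : n = Nat.log 2 i + 1 + k) (c : ℕ) :
    haarEntry n i c =
      (if (i - 2 ^ Nat.log 2 i) * (2 * 2 ^ k) ≤ c ∧ c < (i - 2 ^ Nat.log 2 i) * (2 * 2 ^ k) + 2 ^ k
        then Real.sqrt ((2 ^ Nat.log 2 i : ℝ) / 2 ^ n) else 0) -
      (if (i - 2 ^ Nat.log 2 i) * (2 * 2 ^ k) + 2 ^ k ≤ c ∧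
          c < (i - 2 ^ Nat.log 2 i) * (2 * 2 ^ k) + 2 * 2 ^ k
        then Real.sqrt ((2 ^ Nat.log 2 i : ℝ) / 2 ^ n) else 0) := by
  have hw : 2 ^ n / 2 ^ Nat.log 2 i = 2 * 2 ^ k := by
    rw [Nat.pow_div (by omega) two_pos, ← pow_succ']
    congr 1
    omega
  have hh : 2 ^ n / 2 ^ (Nat.log 2 i + 1) = 2 ^ k := by
    rw [Nat.pow_div (by omega) two_pos]
    congr 1
    omega
  simp only [haarEntry, hi, if_false, hw, hh, add_one_mul]
  split_ifs <;> first | omega | simp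

theorem sum_range_ite_Ico {N a b : ℕ} (hb : b ≤ N) (s : ℝ) :
    (∑ c ∈ Finset.range N, if a ≤ c ∧ c < b then s else 0) = ((b - a : ℕ) : ℝ) * s := by
  have hf : (Finset.range N).filter (fun c => a ≤ c ∧ c < b) = Finset.Ico a b := by
    ext c
    simp only [Finset.mem_filter, Finset.mem_range, Finset.mem_Ico]
    omega
  rw [← Finset.sum_filter, hf, Finset.sum_const, Nat.card_Ico, nsmul_eq_mul]

theorem two_pow_log_le_and_lt {i : ℕ} (hi : i ≠ 0) :
    2 ^ Nat.log 2 i ≤ i ∧ i < 2 * 2 ^ Nat.log 2 i :=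
  ⟨Nat.pow_log_le_self 2 hi, by
    simpa [pow_succ'] using Nat.lt_pow_succ_log_self one_lt_two i⟩

/-- Every row of nonnegative scale of the Haar matrix sums to zero. -/
theorem sum_haarEntry_eq_zero {n i k : ℕ} (hi : i ≠ 0) (hk : n = Nat.log 2 i + 1 + k) :
    ∑ c : Fin (2 ^ n), haarEntry n i c = 0 := by
  have hle : (i - 2 ^ Nat.log 2 i) * (2 * 2 ^ k) + 2 * 2 ^ k ≤ 2 ^ n := by
    obtain ⟨h₁, h₂⟩ := two_pow_log_le_and_lt hi
    calc (i - 2 ^ Nat.log 2 i) * (2 * 2 ^ k) + 2 * 2 ^ k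
        = (i - 2 ^ Nat.log 2 i + 1) * (2 * 2 ^ k) := by ring
      _ ≤ 2 ^ Nat.log 2 i * (2 * 2 ^ k) := Nat.mul_le_mul_right _ (by omega)
      _ = 2 ^ (Nat.log 2 i + 1 + k) := by ring
      _ = 2 ^ n := by rw [← hk]
  rw [Fin.sum_univ_eq_sum_range (haarEntry n i)]
  simp only [haarEntry_eq_sub hi hk, Finset.sum_sub_distrib]
  rw [sum_range_ite_Ico (by omega), sum_range_ite_Ico hle, ← sub_mul]
  rw [show (i - 2 ^ Nat.log 2 i) * (2 * 2 ^ k) + 2 * 2 ^ k -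
      ((i - 2 ^ Nat.log 2 i) * (2 * 2 ^ k) + 2 ^ k) = 2 ^ k by omega, Nat.add_sub_cancel_left]
  simp

/-- A Haar coefficient of `𝟙_{[l,u)}` vanishes unless the support of the row contains an
endpoint `l` or `u`. -/
theorem haarMatrix_mulVec_indVec_eq_zero {n k l u : ℕ} {i : Fin (2 ^ n)} (hlu : l < u)
    (hi : i.val ≠ 0) (hk : n = Nat.log 2 i.val + 1 + k)
    (hl : i.val - 2 ^ Nat.log 2 i.val ≠ l / (2 * 2 ^ k))
    (hu : i.val - 2 ^ Nat.log 2 i.val ≠ u / (2 * 2 ^ k)) :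
    (haarMatrix n).mulVec (indVec (2 ^ n) l u) i = 0 := by
  have hw : 0 < 2 * 2 ^ k := by positivity
  have outside (x : ℕ) (hx : i.val - 2 ^ Nat.log 2 i.val ≠ x / (2 * 2 ^ k)) :
      x < (i.val - 2 ^ Nat.log 2 i.val) * (2 * 2 ^ k) ∨
      (i.val - 2 ^ Nat.log 2 i.val) * (2 * 2 ^ k) + 2 * 2 ^ k ≤ x := by
    rcases lt_or_gt_of_ne hx with h | h
    · right
      simpa [add_one_mul] using (Nat.le_div_iff_mul_le hw).1 (Nat.succ_le_of_lt h)
    · exact Or.inl ((Nat.div_lt_iff_lt_mul hw).1 h)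
  have hl' := outside l hl
  have hu' := outside u hu
  simp only [Matrix.mulVec, dotProduct, haarMatrix, Matrix.of_apply, indVec]
  by_cases hcover : l < (i.val - 2 ^ Nat.log 2 i.val) * (2 * 2 ^ k) ∧
      (i.val - 2 ^ Nat.log 2 i.val) * (2 * 2 ^ k) + 2 * 2 ^ k ≤ u
  · rw [← sum_haarEntry_eq_zero hi hk]
    refine Finset.sum_congr rfl fun c _ => ?_
    rw [haarEntry_eq_sub hi hk]
    split_ifs <;> first | omega | simp
  · refine Finset.sum_eq_zero fun c _ => ?_
    rw [haarEntry_eq_sub hi hk]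
    split_ifs <;> first | omega | simp

/-- For `n ≥ 1`, `Δ = 2^n`, any `0 ≤ l < u ≤ Δ` and any fixed scale `m ∈ {-1,0,…,n-1}`,
the vector `H · 𝟙_{[l,u)}` has at most `2` nonzero entries among the coordinates whose
row index has scale `m`. -/
theorem haar_indicator_nonzero_card_le_two_per_scale (n : ℕ) (hn : 1 ≤ n) (l u : ℕ)
    (hlu : l < u) (hu : u ≤ 2 ^ n) (m : ℤ) (hm₁ : -1 ≤ m) (hm₂ : m < n) :
    (Finset.univ.filter fun i : Fin (2 ^ n) =>
      haarScale i.val = m ∧ (haarMatrix n).mulVec (indVec (2 ^ n) l u) i ≠ 0).card ≤ 2 := by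
  rcases eq_or_ne m (-1) with rfl | hm
  · refine (Finset.card_le_one.2 fun a ha b hb => ?_).trans one_le_two
    have eq_zero (c : Fin (2 ^ n)) (hc : haarScale c.val = -1) : c.val = 0 := by
      by_contra h
      simp only [haarScale, h, if_false] at hc
      omega
    simp only [Finset.mem_filter] at ha hb
    exact Fin.ext ((eq_zero a ha.2.1).trans (eq_zero b hb.2.1).symm)
  · obtain ⟨p, rfl⟩ := Int.eq_ofNat_of_zero_le (show 0 ≤ m by omega)
    obtain ⟨k, hk⟩ := Nat.exists_eq_add_of_le (show p + 1 ≤ n by omega)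
    rw [← Finset.card_map Fin.valEmbedding]
    refine (Finset.card_le_card (t := {2 ^ p + l / (2 * 2 ^ k), 2 ^ p + u / (2 * 2 ^ k)})
      fun x hx => ?_).trans Finset.card_le_two
    simp only [Finset.mem_map, Finset.mem_filter, Finset.mem_univ, true_and] at hx
    obtain ⟨i, ⟨hscale, hne⟩, rfl⟩ := hx
    unfold haarScale at hscale
    split_ifs at hscale with hi
    obtain rfl : Nat.log 2 i.val = p := by exact_mod_cast hscale
    have hpow := (two_pow_log_le_and_lt hi).1
    simp only [Finset.mem_insert, Finset.mem_singleton, Fin.valEmbedding_apply]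
    by_contra! h
    exact hne (haarMatrix_mulVec_indVec_eq_zero hlu hi hk (by omega) (by omega))
end

section
/- Let Z be a real-valued random variable and let f, g : ℝ → ℝ be non-increasing functions such that f(Z), g(Z), and f(Z)·g(Z) are integrable. Then Cov(f(Z), g(Z)) := E[f(Z)g(Z)] − E[f(Z)]·E[g(Z)] ≥ 0. Moreover, Cov(f(Z), g(Z)) = 0 if and only if f(Z) is almost surely constant or g(Z) is almost surely constant. -/
open MeasureTheory

/-- Two functions such that almost every pair of points is not separated by both of them:
one of the two functions is almost everywhere constant. -/
theorem ae_const_or_ae_const_of_ae_ae_eq_or_eq {Ω α β : Type*} [MeasurableSpace Ω]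
    {μ : Measure Ω} [NeZero μ] {X : Ω → α} {Y : Ω → β}
    (h : ∀ᵐ ω ∂μ, ∀ᵐ ω' ∂μ, X ω = X ω' ∨ Y ω = Y ω') :
    (∃ c, ∀ᵐ ω ∂μ, X ω = c) ∨ (∃ c, ∀ᵐ ω ∂μ, Y ω = c) := by
  by_contra! hne
  obtain ⟨hX, hY⟩ := hne
  obtain ⟨ω₀, h₀⟩ := h.exists
  obtain ⟨ω₁, hX₁, h₁, h₀₁⟩ :=
    ((Filter.not_eventually.mp (hX (X ω₀))).and_eventually (h.and h₀)).exists
  obtain ⟨ω₂, hY₂, h₂, h₀₂⟩ :=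
    ((Filter.not_eventually.mp (hY (Y ω₀))).and_eventually (h.and h₀)).exists
  refine hY (Y ω₀) ?_
  filter_upwards [h₀, h₁, h₂] with ω k₀ k₁ k₂
  grind

section Symmetrization

variable {Ω : Type*} [MeasurableSpace Ω] {μ : Measure Ω} [IsProbabilityMeasure μ] {X Y : Ω → ℝ}

theorem integrable_prod_sub_mul_sub (hX : Integrable X μ) (hY : Integrable Y μ)
    (hXY : Integrable (fun ω => X ω * Y ω) μ) :
    Integrable (fun p : Ω × Ω => (X p.1 - X p.2) * (Y p.1 - Y p.2)) (μ.prod μ) := by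
  refine (((hXY.comp_fst μ).add (hXY.comp_snd μ)).sub
    ((hX.mul_prod hY).add (hY.mul_prod hX))).congr (.of_forall fun p => ?_)
  simp only [Pi.add_apply, Pi.sub_apply]
  ring

theorem integral_prod_sub_mul_sub (hX : Integrable X μ) (hY : Integrable Y μ)
    (hXY : Integrable (fun ω => X ω * Y ω) μ) :
    ∫ p : Ω × Ω, (X p.1 - X p.2) * (Y p.1 - Y p.2) ∂μ.prod μ =
      2 * ((∫ ω, X ω * Y ω ∂μ) - (∫ ω, X ω ∂μ) * (∫ ω, Y ω ∂μ)) := by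
  have hexpand : (fun p : Ω × Ω => (X p.1 - X p.2) * (Y p.1 - Y p.2)) =
      ((fun p => X p.1 * Y p.1) + fun p => X p.2 * Y p.2) -
        ((fun p => X p.1 * Y p.2) + fun p => Y p.1 * X p.2) := by
    funext p
    simp only [Pi.add_apply, Pi.sub_apply]
    ring
  rw [hexpand, integral_sub' ((hXY.comp_fst μ).add (hXY.comp_snd μ))
      ((hX.mul_prod hY).add (hY.mul_prod hX)),
    integral_add' (hXY.comp_fst μ) (hXY.comp_snd μ),
    integral_add' (hX.mul_prod hY) (hY.mul_prod hX),
    integral_fun_fst (fun ω => X ω * Y ω), integral_fun_snd (fun ω => X ω * Y ω),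
    integral_prod_mul, integral_prod_mul]
  simp only [probReal_univ, one_smul]
  ring

end Symmetrization

/-- Chebyshev's covariance inequality with equality condition: if `f` and `g` are
non-increasing and `f(Z)`, `g(Z)`, `f(Z)·g(Z)` are integrable, then
`Cov(f(Z), g(Z)) = E[f(Z)g(Z)] − E[f(Z)]·E[g(Z)] ≥ 0`, with equality if and only if
`f(Z)` or `g(Z)` is almost surely constant. -/
theorem antitone_cov_nonneg_and_eq_zero_iff {Ω : Type*} [MeasurableSpace Ω]
    (μ : Measure Ω) [IsProbabilityMeasure μ]
    (Z : Ω → ℝ) (hZ : Measurable Z) (f g : ℝ → ℝ)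
    (hf : Antitone f) (hg : Antitone g)
    (hfi : Integrable (fun ω => f (Z ω)) μ)
    (hgi : Integrable (fun ω => g (Z ω)) μ)
    (hfgi : Integrable (fun ω => f (Z ω) * g (Z ω)) μ) :
    0 ≤ (∫ ω, f (Z ω) * g (Z ω) ∂μ) - (∫ ω, f (Z ω) ∂μ) * (∫ ω, g (Z ω) ∂μ) ∧
    ((∫ ω, f (Z ω) * g (Z ω) ∂μ) - (∫ ω, f (Z ω) ∂μ) * (∫ ω, g (Z ω) ∂μ) = 0 ↔
      (∃ c : ℝ, ∀ᵐ ω ∂μ, f (Z ω) = c) ∨ (∃ c : ℝ, ∀ᵐ ω ∂μ, g (Z ω) = c)) := by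
  have hint := integrable_prod_sub_mul_sub hfi hgi hfgi
  have hcov := integral_prod_sub_mul_sub hfi hgi hfgi
  have hnonneg : 0 ≤ fun p : Ω × Ω =>
      (f (Z p.1) - f (Z p.2)) * (g (Z p.1) - g (Z p.2)) := by
    intro p
    rcases le_total (Z p.1) (Z p.2) with h | h
    · exact mul_nonneg (sub_nonneg.mpr (hf h)) (sub_nonneg.mpr (hg h))
    · exact mul_nonneg_of_nonpos_of_nonpos (sub_nonpos.mpr (hf h)) (sub_nonpos.mpr (hg h))
  refine ⟨by linarith [integral_nonneg (μ := μ.prod μ) hnonneg], fun h => ?_, ?_⟩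
  · rw [h, mul_zero, integral_eq_zero_iff_of_nonneg hnonneg hint] at hcov
    refine ae_const_or_ae_const_of_ae_ae_eq_or_eq ?_
    filter_upwards [Measure.ae_ae_of_ae_prod hcov] with ω hω
    filter_upwards [hω] with ω' hω'
    simpa [sub_eq_zero] using hω'
  · rintro (⟨c, hc⟩ | ⟨c, hc⟩)
    · have hmul : ∫ ω, f (Z ω) * g (Z ω) ∂μ = ∫ ω, c * g (Z ω) ∂μ :=
        integral_congr_ae (hc.mono fun ω h => by simp only [h])
      simp [hmul, integral_congr_ae hc, integral_const_mul]
    · have hmul : ∫ ω, f (Z ω) * g (Z ω) ∂μ = ∫ ω, f (Z ω) * c ∂μ :=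
        integral_congr_ae (hc.mono fun ω h => by simp only [h])
      simp [hmul, integral_congr_ae hc, integral_mul_const]
end

section
/- For every real number z, the Lebesgue integral over ℝ satisfies ∫_{−∞}^{∞} 1/((1+x²)²·(1+(z−x)²)²) dx = π·(20 + z²)/(4 + z²)³. -/
open Real MeasureTheory

open Filter Topology

lemma tendsto_inv_one_add_sq {α : Type*} {l : Filter α} {u : α → ℝ}
    (hu : Tendsto (fun t => |u t|) l atTop) :
    Tendsto (fun t => (1 + u t ^ 2)⁻¹) l (𝓝 0) := by
  refine tendsto_inv_atTop_zero.comp (tendsto_atTop_add_const_left l 1 ?_)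
  simpa [Function.comp_def] using (tendsto_pow_atTop (α := ℝ) two_ne_zero).comp hu

lemma tendsto_div_one_add_sq {α : Type*} {l : Filter α} {u : α → ℝ}
    (hu : Tendsto (fun t => |u t|) l atTop) :
    Tendsto (fun t => u t / (1 + u t ^ 2)) l (𝓝 0) := by
  have h : Tendsto (fun t => (u t)⁻¹) l (𝓝 0) := by
    rw [tendsto_zero_iff_abs_tendsto_zero]
    simpa [Function.comp_def, abs_inv] using tendsto_inv_atTop_zero.comp hu
  have h' := h.mul ((tendsto_const_nhds (x := (1 : ℝ))).sub (tendsto_inv_one_add_sq hu))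
  rw [zero_mul] at h'
  refine h'.congr fun t => ?_
  by_cases ht : u t = 0
  · simp [ht]
  · have : 1 + u t ^ 2 ≠ 0 := by positivity
    field_simp
    ring

lemma tendsto_log_one_add_sq_sub {l : Filter ℝ} (z : ℝ)
    (hy : Tendsto (fun x => |z - x|) l atTop) :
    Tendsto (fun x => log (1 + x ^ 2) - log (1 + (z - x) ^ 2)) l (𝓝 0) := by
  have h : Tendsto (fun x => 1 - 2 * z * ((z - x) / (1 + (z - x) ^ 2))
      + z ^ 2 * (1 + (z - x) ^ 2)⁻¹) l (𝓝 1) := by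
    simpa using ((tendsto_const_nhds (x := (1 : ℝ))).sub
      ((tendsto_div_one_add_sq hy).const_mul (2 * z))).add
      ((tendsto_inv_one_add_sq hy).const_mul (z ^ 2))
  have h' := h.log one_ne_zero
  rw [log_one] at h'
  refine h'.congr fun x => ?_
  have hb : 1 + (z - x) ^ 2 ≠ 0 := by positivity
  rw [← log_div (by positivity) hb]
  congr 1
  field_simp
  ring

lemma integrable_cauchy_sq_mul (z : ℝ) :
    Integrable fun x : ℝ => 1 / ((1 + x ^ 2) ^ 2 * (1 + (z - x) ^ 2) ^ 2) := by
  refine integrable_inv_one_add_sq.mono' ?_ (.of_forall fun x => ?_)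
  · refine Continuous.aestronglyMeasurable (continuous_const.div (by fun_prop) fun x => ?_)
    positivity
  · rw [Real.norm_of_nonneg (by positivity), ← one_div]
    refine one_div_le_one_div_of_le (by positivity) ?_
    have ha : 1 ≤ 1 + x ^ 2 := by nlinarith [sq_nonneg x]
    have hb : 1 ≤ (1 + (z - x) ^ 2) ^ 2 := one_le_pow₀ (by nlinarith [sq_nonneg (z - x)])
    calc 1 + x ^ 2 ≤ (1 + x ^ 2) ^ 2 := le_self_pow₀ ha two_ne_zero
      _ ≤ _ := le_mul_of_one_le_right (by positivity) hb

/-- An antiderivative of `1 / ((1 + x²)² (1 + (z - x)²)²)` for `z ≠ 0`. -/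
noncomputable def cauchySqPrimitive (z x : ℝ) : ℝ :=
  (z ^ 2 * (4 + z ^ 2) ^ 2)⁻¹ *
    ((10 * z ^ 2 + 8) / (4 + z ^ 2) * (arctan x - arctan (z - x))
      + (10 * z ^ 2 + 8) / (z * (4 + z ^ 2)) * (log (1 + x ^ 2) - log (1 + (z - x) ^ 2))
      + (z ^ 2 - 4) / 2 * (arctan x - arctan (z - x)
        + (x / (1 + x ^ 2) - (z - x) / (1 + (z - x) ^ 2)))
      - 2 * z * ((1 + x ^ 2)⁻¹ - (1 + (z - x) ^ 2)⁻¹))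

lemma hasDerivAt_cauchySqPrimitive {z : ℝ} (hz : z ≠ 0) (x : ℝ) :
    HasDerivAt (cauchySqPrimitive z) (1 / ((1 + x ^ 2) ^ 2 * (1 + (z - x) ^ 2) ^ 2)) x := by
  have ha : 1 + x ^ 2 ≠ 0 := by positivity
  have hb : 1 + (z - x) ^ 2 ≠ 0 := by positivity
  have hD : 4 + z ^ 2 ≠ 0 := by positivity
  have hx := hasDerivAt_id' x
  have hy := hx.const_sub z
  have hA := (hx.pow 2).const_add 1
  have hB := (hy.pow 2).const_add 1
  have hT := hx.arctan.sub hy.arctan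
  have h := ((((hT.const_mul ((10 * z ^ 2 + 8) / (4 + z ^ 2))).add
    (((hA.log ha).sub (hB.log hb)).const_mul ((10 * z ^ 2 + 8) / (z * (4 + z ^ 2))))).add
    ((hT.add ((hx.div hA ha).sub (hy.div hB hb))).const_mul ((z ^ 2 - 4) / 2))).sub
    (((hA.inv ha).sub (hB.inv hb)).const_mul (2 * z))).const_mul (z ^ 2 * (4 + z ^ 2) ^ 2)⁻¹
  refine h.congr_deriv ?_
  simp only [Pi.pow_apply]
  field_simp
  ring

lemma tendsto_cauchySqPrimitive {z s t : ℝ} {l : Filter ℝ}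
    (hx : Tendsto (fun x => |x|) l atTop) (hy : Tendsto (fun x => |z - x|) l atTop)
    (hs : Tendsto arctan l (𝓝 s)) (ht : Tendsto (fun x => arctan (z - x)) l (𝓝 t)) :
    Tendsto (cauchySqPrimitive z) l (𝓝 ((z ^ 2 * (4 + z ^ 2) ^ 2)⁻¹ *
      ((10 * z ^ 2 + 8) / (4 + z ^ 2) * (s - t) + (z ^ 2 - 4) / 2 * (s - t)))) := by
  have hT := hs.sub ht
  have h := ((((hT.const_mul ((10 * z ^ 2 + 8) / (4 + z ^ 2))).add
    ((tendsto_log_one_add_sq_sub z hy).const_mul ((10 * z ^ 2 + 8) / (z * (4 + z ^ 2))))).add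
    ((hT.add ((tendsto_div_one_add_sq hx).sub (tendsto_div_one_add_sq hy))).const_mul
      ((z ^ 2 - 4) / 2))).sub
    (((tendsto_inv_one_add_sq hx).sub (tendsto_inv_one_add_sq hy)).const_mul (2 * z))).const_mul
    (z ^ 2 * (4 + z ^ 2) ^ 2)⁻¹
  simp only [sub_zero, mul_zero, add_zero] at h
  exact h

/-- An antiderivative of `1 / (1 + x²)⁴`. -/
lemma hasDerivAt_primitive_inv_one_add_sq_pow_four (x : ℝ) :
    HasDerivAt (fun x : ℝ => x / (1 + x ^ 2) *
        (1 / 6 * ((1 + x ^ 2)⁻¹ * (1 + x ^ 2)⁻¹) + 5 / 24 * (1 + x ^ 2)⁻¹ + 5 / 16)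
        + 5 / 16 * arctan x)
      (1 / ((1 + x ^ 2) ^ 2 * (1 + (0 - x) ^ 2) ^ 2)) x := by
  have ha : 1 + x ^ 2 ≠ 0 := by positivity
  have hx := hasDerivAt_id' x
  have hA := (hx.pow 2).const_add 1
  have hI := hA.inv ha
  have h := ((hx.div hA ha).mul ((((hI.mul hI).const_mul (1 / 6)).add
    (hI.const_mul (5 / 24))).add_const (5 / 16))).add (hx.arctan.const_mul (5 / 16))
  refine h.congr_deriv ?_
  simp [-one_div]
  field_simp
  ring

lemma tendsto_primitive_inv_one_add_sq_pow_four {s : ℝ} {l : Filter ℝ}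
    (hx : Tendsto (fun x => |x|) l atTop) (hs : Tendsto arctan l (𝓝 s)) :
    Tendsto (fun x : ℝ => x / (1 + x ^ 2) *
        (1 / 6 * ((1 + x ^ 2)⁻¹ * (1 + x ^ 2)⁻¹) + 5 / 24 * (1 + x ^ 2)⁻¹ + 5 / 16)
        + 5 / 16 * arctan x) l (𝓝 (5 / 16 * s)) := by
  have hI := tendsto_inv_one_add_sq hx
  have h := ((tendsto_div_one_add_sq hx).mul ((((hI.mul hI).const_mul (1 / 6)).add
    (hI.const_mul (5 / 24))).add_const (5 / 16))).add (hs.const_mul (5 / 16))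
  rwa [zero_mul, zero_add] at h

/-- For every real `z`,
`∫_{−∞}^{∞} 1/((1+x²)²·(1+(z−x)²)²) dx = π·(20 + z²)/(4 + z²)³`. -/
theorem cauchy_convolution_integral (z : ℝ) :
    ∫ x : ℝ, 1 / ((1 + x ^ 2) ^ 2 * (1 + (z - x) ^ 2) ^ 2) =
      π * (20 + z ^ 2) / (4 + z ^ 2) ^ 3 := by
  have htop : Tendsto arctan atTop (𝓝 (π / 2)) :=
    tendsto_nhds_of_tendsto_nhdsWithin tendsto_arctan_atTop
  have hbot : Tendsto arctan atBot (𝓝 (-(π / 2))) :=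
    tendsto_nhds_of_tendsto_nhdsWithin tendsto_arctan_atBot
  rcases eq_or_ne z 0 with rfl | hz
  · rw [integral_of_hasDerivAt_of_tendsto hasDerivAt_primitive_inv_one_add_sq_pow_four
      (integrable_cauchy_sq_mul 0)
      (tendsto_primitive_inv_one_add_sq_pow_four tendsto_abs_atBot_atTop hbot)
      (tendsto_primitive_inv_one_add_sq_pow_four tendsto_abs_atTop_atTop htop)]
    ring
  · have hyt : Tendsto (fun x => z - x) atTop atBot := by
      simpa [sub_eq_add_neg] using tendsto_atBot_add_const_left _ z tendsto_neg_atTop_atBot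
    have hyb : Tendsto (fun x => z - x) atBot atTop := by
      simpa [sub_eq_add_neg] using tendsto_atTop_add_const_left _ z tendsto_neg_atBot_atTop
    rw [integral_of_hasDerivAt_of_tendsto (hasDerivAt_cauchySqPrimitive hz)
      (integrable_cauchy_sq_mul z)
      (tendsto_cauchySqPrimitive tendsto_abs_atBot_atTop (tendsto_abs_atTop_atTop.comp hyb)
        hbot (htop.comp hyb))
      (tendsto_cauchySqPrimitive tendsto_abs_atTop_atTop (tendsto_abs_atBot_atTop.comp hyt)
        htop (hbot.comp hyt))]
    have hD : 4 + z ^ 2 ≠ 0 := by positivity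
    field_simp
    ring
end
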